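/- Let A > 0, p > 1, λ > 0 and let H : [0,A] → ℝ be a positive C¹ function. Assume that for each d > 0 a C² function w_d : [0,A] → ℝ satisfies w_d''(r) + (H(r)/r)·w_d'(r) + λ·(|w_d(r)|^{p−1}·w_d(r) − w_d(r)) = 0 on (0,A], with w_d(0) = d, w_d'(0) = 0, and let v₀ : [0,∞) → ℝ be a C² function satisfying v₀''(r) + (H(0)/r)·v₀'(r) + |v₀(r)|^{p−1}·v₀(r) = 0 on (0,∞), v₀(0) = 1, v₀'(0) = 0. For d > 0 define z_d(r) = d^{−2/(p−1)} · w_{d^{2/(p−1)}}(r/(d·√λ)) for r ∈ [0, d·A·√λ]. Then for every K > 0, z_d converges to v₀ in the C¹ sense uniformly on [0,K] as d → ∞; that is, sup_{r ∈ [0,K]} (|z_d(r) − v₀(r)| + |z_d'(r) − v₀'(r)|) → 0 as d → ∞. -/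

import Mathlib

lemma reg (B : ℝ) (hB : 0 < B) (f H F : ℝ → ℝ) (hf : ContDiffOn ℝ 2 f (Set.Icc 0 B))
    (hH : ContinuousOn H (Set.Icc 0 B)) (hF : ContinuousOn F (Set.Icc 0 B)) (H0 : 0 < H 0)
    (ode : ∀ r ∈ Set.Ioo 0 B, deriv (deriv f) r + H r / r * deriv f r + F r = 0) :
    ∃ g : ℝ → ℝ, ContinuousOn g (Set.Icc 0 B) ∧ g 0 = 0 ∧ ∀ r ∈ Set.Ioo 0 B,
      HasDerivAt f (g r) r ∧ HasDerivAt g (- (H r / r * g r) - F r) r := by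
  have hU : UniqueDiffOn ℝ (Set.Icc 0 B) := uniqueDiffOn_Icc hB
  set g := derivWithin f (Set.Icc 0 B) with hg
  have hg1 : ContDiffOn ℝ 1 g (Set.Icc 0 B) := hf.derivWithin hU (by norm_num)
  set g1 := derivWithin g (Set.Icc 0 B) with hg1d
  have hg1c : ContinuousOn g1 (Set.Icc 0 B) := hg1.continuousOn_derivWithin hU (by norm_num)
  have hnhds : ∀ r ∈ Set.Ioo 0 B, Set.Icc 0 B ∈ nhds r := fun r hr => Icc_mem_nhds hr.1 hr.2
  have hd : ∀ r ∈ Set.Ioo 0 B, deriv f r = g r := fun r hr =>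
    (derivWithin_of_mem_nhds (hnhds r hr)).symm
  have hfd : ∀ r ∈ Set.Ioo 0 B, HasDerivAt f (g r) r := by
    intro r hr
    rw [← hd r hr]
    exact ((hf.differentiableOn (by norm_num)).differentiableAt (hnhds r hr)).hasDerivAt
  have hdd : ∀ r ∈ Set.Ioo 0 B, deriv (deriv f) r = g1 r := by
    intro r hr
    have : deriv f =ᶠ[nhds r] g := by
      filter_upwards [isOpen_Ioo.mem_nhds hr] with x hx using hd x hx
    rw [this.deriv_eq]
    exact (derivWithin_of_mem_nhds (hnhds r hr)).symm
  have hgd : ∀ r ∈ Set.Ioo 0 B, HasDerivAt g (g1 r) r := by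
    intro r hr
    have := ((hg1.differentiableOn (by norm_num)).differentiableAt (hnhds r hr)).hasDerivAt
    rwa [← derivWithin_of_mem_nhds (hnhds r hr)] at this
  refine ⟨g, hg1.continuousOn, ?_, ?_⟩
  · have e : Set.EqOn (fun r => H r * g r) (fun r => - r * (g1 r + F r)) (Set.Ioo 0 B) := by
      intro r hr
      have h := ode r hr
      rw [hdd r hr, hd r hr] at h
      have : r ≠ 0 := hr.1.ne'
      field_simp at h
      simp only
      linarith
    have e2 := e.of_subset_closure (t := Set.Icc 0 B) (hH.mul hg1.continuousOn)
      (continuousOn_id.neg.mul (hg1c.add hF)) Set.Ioo_subset_Icc_self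
      (by rw [closure_Ioo hB.ne])
    have := e2 (Set.left_mem_Icc.2 hB.le)
    simp only [neg_zero, zero_mul] at this
    rcases mul_eq_zero.1 this with h | h
    · exact absurd h H0.ne'
    · exact h
  · intro r hr
    refine ⟨hfd r hr, ?_⟩
    convert hgd r hr using 1
    have h := ode r hr
    rw [hdd r hr, hd r hr] at h
    linarith

lemma anti_bound (K : ℝ) (E E' : ℝ → ℝ) (hc : ContinuousOn E (Set.Icc 0 K))
    (hd : ∀ r ∈ Set.Ioo 0 K, HasDerivAt E (E' r) r) (hn : ∀ r ∈ Set.Ioo 0 K, E' r ≤ 0) :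
    ∀ r ∈ Set.Icc 0 K, E r ≤ E 0 := by
  intro r hr
  have : AntitoneOn E (Set.Icc 0 K) := by
    apply antitoneOn_of_deriv_nonpos (convex_Icc 0 K) hc
    · intro x hx
      rw [interior_Icc] at hx
      exact (hd x hx).differentiableAt.differentiableWithinAt
    · intro x hx
      rw [interior_Icc] at hx
      rw [(hd x hx).deriv]; exact hn x hx
  exact this (Set.left_mem_Icc.2 (hr.1.trans hr.2)) hr hr.1

lemma energy (K p e : ℝ) (hp : 1 < p) (he0 : 0 ≤ e) (he1 : e ≤ 1) (z q h : ℝ → ℝ)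
    (hz : ContinuousOn z (Set.Icc 0 K)) (hq : ContinuousOn q (Set.Icc 0 K))
    (z0 : z 0 = 1) (q0 : q 0 = 0) (hh : ∀ r ∈ Set.Ioo 0 K, 0 ≤ h r)
    (hd : ∀ r ∈ Set.Ioo 0 K, HasDerivAt z (q r) r)
    (hd2 : ∀ r ∈ Set.Ioo 0 K,
      HasDerivAt q (- (h r * q r) - (|z r| ^ (p - 1) * z r - e * z r)) r) :
    ∀ r ∈ Set.Icc 0 K, |z r| ≤ ((p + 3) / 2) ^ (1 / (p - 1)) := by
  have key := anti_bound K (fun r => q r ^ 2 / 2 + |z r| ^ (p + 1) / (p + 1) - e * z r ^ 2 / 2)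
    (fun r => - h r * q r ^ 2) ?_ ?_ ?_
  · intro r hr
    have k := key r hr
    simp only [z0, q0, abs_one, Real.one_rpow] at k
    by_contra hcon
    push Not at hcon
    have hb : 1 ≤ ((p + 3) / 2) ^ (1 / (p - 1)) :=
      Real.one_le_rpow (by linarith) (by apply div_nonneg <;> linarith)
    have hz1 : 1 < |z r| := by linarith
    have h1 : (p + 3) / 2 < |z r| ^ (p - 1) := by
      have := Real.rpow_lt_rpow (by linarith) hcon (by linarith : 0 < p - 1)
      rwa [← Real.rpow_mul (by linarith), one_div_mul_cancel (by linarith), Real.rpow_one] at this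
    have h2 : |z r| ^ (p + 1) = |z r| ^ (p - 1) * z r ^ 2 := by
      rw [← sq_abs (z r), ← Real.rpow_natCast, ← Real.rpow_add (by linarith)]
      congr 1; push_cast; ring
    rw [h2] at k
    have h3 : 1 < z r ^ 2 := by rw [← sq_abs]; nlinarith
    have h4 : (p + 3) / 2 * z r ^ 2 < |z r| ^ (p - 1) * z r ^ 2 := by nlinarith
    have h5 : (p + 3) / 2 * z r ^ 2 / (p + 1) < |z r| ^ (p - 1) * z r ^ 2 / (p + 1) := by
      apply div_lt_div_of_pos_right h4; linarith
    have h6 : (p + 3) / 2 * z r ^ 2 / (p + 1) = z r ^ 2 / 2 + z r ^ 2 / (p + 1) := by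
      have : p + 1 ≠ 0 := by linarith
      field_simp; ring
    have h7 : 1 / (p + 1) ≤ z r ^ 2 / (p + 1) := by
      apply div_le_div_of_nonneg_right h3.le; linarith
    nlinarith [sq_nonneg (q r)]
  · refine ((hq.pow 2).div_const 2 |>.add ((hz.abs.rpow_const ?_).div_const _)).sub
      ((continuousOn_const.mul (hz.pow 2)).div_const 2)
    intro x _; right; linarith
  · intro r hr
    have a1 := ((hd2 r hr).pow 2).div_const 2
    have a2 := ((hasDerivAt_abs_rpow (z r) (by linarith : 1 < p + 1)).comp r (hd r hr)).div_const (p + 1)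
    have a3 := (((hd r hr).pow 2).const_mul e).div_const 2
    refine ((a1.add a2).sub a3).congr_deriv ?_
    have : p + 1 ≠ 0 := by linarith
    rw [show p + 1 - 2 = p - 1 by ring]
    field_simp
    push_cast
    ring
  · intro r hr
    have := hh r hr
    nlinarith [mul_nonneg this (sq_nonneg (q r))]

lemma phi_deriv (p : ℝ) (hp : 1 < p) (x : ℝ) :
    HasDerivAt (fun x : ℝ => |x| ^ (p - 1) * x) (p * |x| ^ (p - 1)) x := by
  rcases eq_or_ne x 0 with rfl | hx
  · rw [hasDerivAt_iff_tendsto_slope]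
    have : Filter.Tendsto (fun x : ℝ => |x| ^ (p - 1)) (nhdsWithin 0 {0}ᶜ) (nhds (|0| ^ (p - 1))) := by
      apply Filter.Tendsto.mono_left _ nhdsWithin_le_nhds
      exact (continuous_abs.rpow_const (fun x => Or.inr (by linarith))).tendsto 0
    rw [abs_zero, Real.zero_rpow (by linarith), mul_zero] at *
    refine this.congr' ?_
    filter_upwards [self_mem_nhdsWithin] with y hy
    have : y ≠ 0 := hy
    simp [slope_def_field, this]
  · have ha : 0 < |x| := abs_pos.2 hx
    have h1 := ((hasDerivAt_abs hx).rpow_const (p := p - 1) (Or.inl ha.ne')).mul (hasDerivAt_id x)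
    refine h1.congr_deriv ?_
    have h2 : |x| ^ (p - 1) = |x| ^ (p - 1 - 1) * |x| := by
      rw [Real.rpow_sub_one ha.ne' (p - 1)]; field_simp
    have h3 : (SignType.sign x : ℝ) * x = |x| := sign_mul_self x
    simp only [id]
    rw [h2, ← h3]; ring

lemma phi_lip (p M : ℝ) (hp : 1 < p) (x y : ℝ) (hx : |x| ≤ M) (hy : |y| ≤ M) :
    |(|x| ^ (p - 1) * x) - (|y| ^ (p - 1) * y)| ≤ p * M ^ (p - 1) * |x - y| := by
  have := (convex_Icc (-M) M).norm_image_sub_le_of_norm_hasDerivWithin_le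
    (f := fun x : ℝ => |x| ^ (p - 1) * x) (f' := fun x => p * |x| ^ (p - 1))
    (C := p * M ^ (p - 1)) (fun t _ => (phi_deriv p hp t).hasDerivWithinAt) ?_
    (abs_le.1 hy) (abs_le.1 hx)
  · simpa using this
  · intro t ht
    have ht' : |t| ≤ M := abs_le.2 ht
    rw [Real.norm_of_nonneg (by positivity)]
    have := Real.rpow_le_rpow (abs_nonneg t) ht' (by linarith : 0 ≤ p - 1)
    gcongr

lemma gron (K Λ η : ℝ) (hΛ : 0 ≤ Λ) (hη : 0 ≤ η) (u y y' : ℝ → ℝ)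
    (hu : ContinuousOn u (Set.Icc 0 K)) (hy : ContinuousOn y (Set.Icc 0 K))
    (u0 : u 0 = 0) (y0 : y 0 = 0)
    (hd : ∀ r ∈ Set.Ioo 0 K, HasDerivAt u (y r) r)
    (hd2 : ∀ r ∈ Set.Ioo 0 K, HasDerivAt y (y' r) r)
    (hb : ∀ r ∈ Set.Ioo 0 K, y r * y' r ≤ |y r| * (Λ * |u r| + η)) :
    ∀ r ∈ Set.Icc 0 K, |u r| + |y r| ≤ 2 * (η * Real.exp ((Λ + 2) * K)) := by
  have key := anti_bound K (fun r => (u r ^ 2 + y r ^ 2 + η ^ 2) * Real.exp (- (Λ + 2) * r))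
    (fun r => (2 * u r * y r + 2 * y r * y' r) * Real.exp (- (Λ + 2) * r) +
      (u r ^ 2 + y r ^ 2 + η ^ 2) * (Real.exp (- (Λ + 2) * r) * (- (Λ + 2)))) ?_ ?_ ?_
  · intro r hr
    have k := key r hr
    simp only [u0, y0, mul_zero, Real.exp_zero] at k
    have e1 : Real.exp (-(Λ + 2) * r) * Real.exp ((Λ + 2) * r) = 1 := by
      rw [← Real.exp_add, show -(Λ + 2) * r + (Λ + 2) * r = 0 by ring, Real.exp_zero]
    have e2 : Real.exp ((Λ + 2) * r) ≤ Real.exp ((Λ + 2) * K) := by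
      apply Real.exp_le_exp.2; nlinarith [hr.2]
    have e3 : 1 ≤ Real.exp ((Λ + 2) * r) := by
      apply Real.one_le_exp; nlinarith [hr.1]
    set X := Real.exp ((Λ + 2) * r)
    set Y := Real.exp ((Λ + 2) * K)
    have k2 : u r ^ 2 + y r ^ 2 + η ^ 2 ≤ η ^ 2 * X := by
      have := mul_le_mul_of_nonneg_right k (by linarith : 0 ≤ X)
      rw [mul_assoc, e1] at this
      linarith
    have k3 : η ^ 2 * X ≤ (η * Y) ^ 2 := by
      have : X ≤ Y ^ 2 := by nlinarith
      nlinarith [mul_le_mul_of_nonneg_left this (sq_nonneg η)]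
    have hY : 0 ≤ η * Y := by apply mul_nonneg hη; linarith
    have b1 : |u r| ≤ η * Y := abs_le_of_sq_le_sq (by nlinarith [sq_nonneg (y r), sq_nonneg η]) hY
    have b2 : |y r| ≤ η * Y := abs_le_of_sq_le_sq (by nlinarith [sq_nonneg (u r), sq_nonneg η]) hY
    linarith
  · refine (((hu.pow 2).add (hy.pow 2)).add continuousOn_const).mul ?_
    fun_prop
  · intro r hr
    have a1 := (((hd r hr).pow 2).add ((hd2 r hr).pow 2)).add_const (η ^ 2)
    have a2 : HasDerivAt (fun r => Real.exp (- (Λ + 2) * r))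
        (Real.exp (- (Λ + 2) * r) * (- (Λ + 2))) r := by
      have := ((hasDerivAt_id r).const_mul (-(Λ + 2))).exp
      simpa using this
    refine (a1.mul a2).congr_deriv ?_
    simp
  · intro r hr
    have b := hb r hr
    have hX := Real.exp_pos (- (Λ + 2) * r)
    set X := Real.exp (- (Λ + 2) * r)
    have c1 : u r * y r ≤ |u r| * |y r| := by rw [← abs_mul]; exact le_abs_self _
    have c2 : 2 * u r * y r + 2 * y r * y' r ≤ (Λ + 2) * (u r ^ 2 + y r ^ 2 + η ^ 2) := by
      rw [← sq_abs (u r), ← sq_abs (y r)]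
      nlinarith [mul_nonneg hΛ (sq_nonneg (|u r| - |y r|)), sq_nonneg (|u r| - |y r|), sq_nonneg (|y r| - η), sq_nonneg η, mul_nonneg hΛ (sq_nonneg η), sq_nonneg (u r), sq_nonneg (|u r|)]
    nlinarith [mul_le_mul_of_nonneg_right c2 hX.le]

lemma resc (A p lam m c e K : ℝ) (hA : 0 < A) (hp : 1 < p) (hm : 0 < m) (hc : 0 < c)
    (hce : c ^ (p - 1) = e) (hme : lam / m ^ 2 = e) (hK : K / m < A)
    (H : ℝ → ℝ) (H0 : 0 < H 0) (HC : ContinuousOn H (Set.Icc 0 A))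
    (w : ℝ → ℝ) (hw : ContDiffOn ℝ 2 w (Set.Icc 0 A))
    (ode : ∀ r ∈ Set.Ioc (0 : ℝ) A, deriv (deriv w) r + (H r / r) * deriv w r
        + lam * (|w r| ^ (p - 1) * w r - w r) = 0) :
    ∃ q : ℝ → ℝ, ContinuousOn q (Set.Icc 0 K) ∧
      ContinuousOn (fun s => c * w (s / m)) (Set.Icc 0 K) ∧ q 0 = 0 ∧ ∀ r ∈ Set.Ioc 0 K,
      HasDerivAt (fun s => c * w (s / m)) (q r) r ∧
      HasDerivAt q (- (H (r / m) / r * q r) -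
        (|c * w (r / m)| ^ (p - 1) * (c * w (r / m)) - e * (c * w (r / m)))) r := by
  have hFc : ContinuousOn (fun r => lam * (|w r| ^ (p - 1) * w r - w r)) (Set.Icc 0 A) := by
    have hwc := hw.continuousOn
    exact continuousOn_const.mul (((hwc.abs.rpow_const
      (fun x _ => Or.inr (by linarith))).mul hwc).sub hwc)
  obtain ⟨g, gc, g0, hg⟩ := reg A hA w H _ hw HC hFc H0
    (fun r hr => ode r ⟨hr.1, hr.2.le⟩)
  have hmaps : Set.MapsTo (fun s : ℝ => s / m) (Set.Icc 0 K) (Set.Icc 0 A) := by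
    intro s hs
    refine ⟨div_nonneg hs.1 hm.le, ?_⟩
    have : s / m ≤ K / m := div_le_div_of_nonneg_right hs.2 hm.le
    simp only; linarith
  have hdc : ContinuousOn (fun s : ℝ => s / m) (Set.Icc 0 K) := by fun_prop
  refine ⟨fun s => c / m * g (s / m), continuousOn_const.mul (gc.comp hdc hmaps),
    continuousOn_const.mul (hw.continuousOn.comp hdc hmaps), by simp [g0], ?_⟩
  intro r hr
  have hr0 : r ≠ 0 := hr.1.ne'
  have hrm : r / m ∈ Set.Ioo 0 A := by
    refine ⟨div_pos hr.1 hm, ?_⟩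
    have : r / m ≤ K / m := div_le_div_of_nonneg_right hr.2 hm.le
    linarith
  obtain ⟨h1, h2⟩ := hg _ hrm
  have hdiv : HasDerivAt (fun s : ℝ => s / m) (1 / m) r := (hasDerivAt_id r).div_const m
  constructor
  · refine ((h1.comp r hdiv).const_mul c).congr_deriv ?_
    ring
  · refine ((h2.comp r hdiv).const_mul (c / m)).congr_deriv ?_
    rw [abs_mul, abs_of_pos hc, Real.mul_rpow hc.le (abs_nonneg _), hce, ← hme]
    field_simp

lemma step (A p lam m c e K L V M : ℝ) (hA : 0 < A) (hp : 1 < p) (hm : 0 < m) (hc : 0 < c)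
    (hce : c ^ (p - 1) = e) (hme : lam / m ^ 2 = e) (hK : K / m < A) (he0 : 0 ≤ e) (he1 : e ≤ 1)
    (hM : ((p + 3) / 2) ^ (1 / (p - 1)) ≤ M) (hL : 0 ≤ L) (hV : 0 ≤ V)
    (H : ℝ → ℝ) (Hpos : ∀ r ∈ Set.Icc (0 : ℝ) A, 0 < H r) (HC : ContinuousOn H (Set.Icc 0 A))
    (HL : ∀ r ∈ Set.Icc (0 : ℝ) A, |H r - H 0| ≤ L * r)
    (w : ℝ → ℝ) (hw : ContDiffOn ℝ 2 w (Set.Icc 0 A))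
    (ode : ∀ r ∈ Set.Ioc (0 : ℝ) A, deriv (deriv w) r + (H r / r) * deriv w r
        + lam * (|w r| ^ (p - 1) * w r - w r) = 0) (hw0 : c * w 0 = 1)
    (v g : ℝ → ℝ) (vc : ContinuousOn v (Set.Icc 0 K)) (gc : ContinuousOn g (Set.Icc 0 K))
    (v0 : v 0 = 1) (g0 : g 0 = 0) (hvM : ∀ r ∈ Set.Icc 0 K, |v r| ≤ M)
    (hgV : ∀ r ∈ Set.Icc 0 K, |g r| ≤ V)
    (hv : ∀ r ∈ Set.Ioo 0 K, HasDerivAt v (g r) r)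
    (hg : ∀ r ∈ Set.Ioo 0 K, HasDerivAt g (-(H 0 / r * g r) - |v r| ^ (p - 1) * v r) r) :
    ∀ r ∈ Set.Ioc 0 K, |c * w (r / m) - v r| + |deriv (fun s => c * w (s / m)) r - g r| ≤
      2 * ((L * V / m + e * M) * Real.exp ((p * M ^ (p - 1) + 2) * K)) := by
  obtain ⟨q, qc, zc, q0, hq⟩ := resc A p lam m c e K hA hp hm hc hce hme hK H
    (Hpos 0 ⟨le_rfl, hA.le⟩) HC w hw ode
  have hM0 : 0 ≤ M := le_trans (Real.rpow_nonneg (by linarith) _) hM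
  have hrm : ∀ r ∈ Set.Icc 0 K, r / m ∈ Set.Icc 0 A := by
    intro r hr
    refine ⟨div_nonneg hr.1 hm.le, ?_⟩
    have : r / m ≤ K / m := div_le_div_of_nonneg_right hr.2 hm.le
    linarith
  have hz := energy K p e hp he0 he1 (fun s => c * w (s / m)) q (fun r => H (r / m) / r) zc qc
    (by simpa using hw0) q0
    (fun r hr => div_nonneg (Hpos _ (hrm r ⟨hr.1.le, hr.2.le⟩)).le hr.1.le)
    (fun r hr => (hq r ⟨hr.1, hr.2.le⟩).1) (fun r hr => (hq r ⟨hr.1, hr.2.le⟩).2)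
  have hzM : ∀ r ∈ Set.Icc 0 K, |c * w (r / m)| ≤ M := fun r hr => (hz r hr).trans hM
  have main := gron K (p * M ^ (p - 1)) (L * V / m + e * M) (by positivity) (by positivity)
    (fun s => c * w (s / m) - v s) (fun s => q s - g s) _ (zc.sub vc) (qc.sub gc)
    (by simp [hw0, v0]) (by simp [q0, g0])
    (fun r hr => (hq r ⟨hr.1, hr.2.le⟩).1.sub (hv r hr))
    (fun r hr => (hq r ⟨hr.1, hr.2.le⟩).2.sub (hg r hr)) ?_
  · intro r hr
    rw [(hq r hr).1.deriv]
    exact main r ⟨hr.1.le, hr.2⟩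
  · intro r hr
    have hr' : r ∈ Set.Icc 0 K := ⟨hr.1.le, hr.2.le⟩
    have hr0 : r ≠ 0 := hr.1.ne'
    have l1 := phi_lip p M hp _ _ (hzM r hr') (hvM r hr')
    have l2 := hzM r hr'
    have l3 := HL _ (hrm r hr')
    have l4 := hgV r hr'
    have l5 : 0 ≤ H (r / m) / r := div_nonneg (Hpos _ (hrm r hr')).le hr.1.le
    set z := c * w (r / m)
    set y := q r - g r with hy
    have id1 : y * (-(H (r / m) / r * q r) - (|z| ^ (p - 1) * z - e * z) -
        (-(H 0 / r * g r) - |v r| ^ (p - 1) * v r)) =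
        - (H (r / m) / r * y ^ 2) + y * (-((|z| ^ (p - 1) * z) - |v r| ^ (p - 1) * v r)
          - (H (r / m) - H 0) / r * g r + e * z) := by
      rw [hy]; field_simp; ring
    rw [id1]
    have b1 : |(H (r / m) - H 0) / r * g r| ≤ L * V / m := by
      rw [abs_mul, abs_div, abs_of_pos hr.1]
      have : |H (r / m) - H 0| / r ≤ L / m := by
        rw [div_le_iff₀ hr.1]; calc _ ≤ _ := l3
          _ = _ := by ring
      calc _ ≤ L / m * V := mul_le_mul this l4 (abs_nonneg _) (by positivity)
        _ = _ := by ring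
    have b2 : |e * z| ≤ e * M := by
      rw [abs_mul, abs_of_nonneg he0]; gcongr
    have b3 : |-((|z| ^ (p - 1) * z) - |v r| ^ (p - 1) * v r)
          - (H (r / m) - H 0) / r * g r + e * z| ≤
          p * M ^ (p - 1) * |z - v r| + (L * V / m + e * M) := by
      rw [abs_le] at l1 b1 b2 ⊢
      constructor <;> linarith [l1.1, l1.2, b1.1, b1.2, b2.1, b2.2]
    have b4 := mul_le_mul_of_nonneg_left b3 (abs_nonneg y)
    rw [← abs_mul] at b4
    have b5 := (le_abs_self _).trans b4
    have b6 := mul_nonneg l5 (sq_nonneg y)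
    linarith


/-- Lemma 3.2: the rescaled solutions `z_d(r) = d^{-2/(p-1)} w_{d^{2/(p-1)}}(r/(d√λ))`
converge `C¹`-uniformly on compact intervals to the solution `v₀` of the limit
Cauchy problem, as `d → ∞`. -/
theorem rescaled_solutions_converge_to_limit_problem
    (A p lam : ℝ) (hA : 0 < A) (hp : 1 < p) (hlam : 0 < lam)
    (H : ℝ → ℝ) (Hpos : ∀ r ∈ Set.Icc (0 : ℝ) A, 0 < H r)
    (HC1 : ContDiffOn ℝ 1 H (Set.Icc 0 A))
    (W : ℝ → ℝ → ℝ)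
    (hWC2 : ∀ d : ℝ, 0 < d → ContDiffOn ℝ 2 (W d) (Set.Icc 0 A))
    (hWode : ∀ d : ℝ, 0 < d → ∀ r ∈ Set.Ioc (0 : ℝ) A,
      deriv (deriv (W d)) r + (H r / r) * deriv (W d) r
        + lam * (|W d r| ^ (p - 1) * W d r - W d r) = 0)
    (hW0 : ∀ d : ℝ, 0 < d → W d 0 = d)
    (hW'0 : ∀ d : ℝ, 0 < d → deriv (W d) 0 = 0)
    (v₀ : ℝ → ℝ) (hv₀C2 : ContDiffOn ℝ 2 v₀ (Set.Ici 0))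
    (hv₀ode : ∀ r ∈ Set.Ioi (0 : ℝ),
      deriv (deriv v₀) r + (H 0 / r) * deriv v₀ r + |v₀ r| ^ (p - 1) * v₀ r = 0)
    (hv₀0 : v₀ 0 = 1) (hv₀'0 : deriv v₀ 0 = 0) :
    ∀ K : ℝ, 0 < K →
      Filter.Tendsto
        (fun d : ℝ =>
          ⨆ r : Set.Icc (0 : ℝ) K,
            (|(fun s : ℝ => d ^ (-(2 : ℝ) / (p - 1)) *
                W (d ^ ((2 : ℝ) / (p - 1))) (s / (d * Real.sqrt lam))) (r : ℝ) - v₀ (r : ℝ)| +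
             |deriv (fun s : ℝ => d ^ (-(2 : ℝ) / (p - 1)) *
                W (d ^ ((2 : ℝ) / (p - 1))) (s / (d * Real.sqrt lam))) (r : ℝ) - deriv v₀ (r : ℝ)|))
        Filter.atTop (nhds 0) := by
  intro K hK
  have H0 : 0 < H 0 := Hpos 0 ⟨le_rfl, hA.le⟩
  have hsub : Set.Icc 0 (K + 1) ⊆ Set.Ici (0 : ℝ) := fun x hx => hx.1
  have hsubK : Set.Icc 0 K ⊆ Set.Icc 0 (K + 1) := Set.Icc_subset_Icc_right (by linarith)
  have hvC := hv₀C2.mono hsub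
  have hvc := hvC.continuousOn
  obtain ⟨g, gc, g0, hg⟩ := reg (K + 1) (by linarith) v₀ (fun _ => H 0)
    (fun r => |v₀ r| ^ (p - 1) * v₀ r) hvC continuousOn_const
    ((hvc.abs.rpow_const (fun x _ => Or.inr (by linarith))).mul hvc) H0
    (fun r hr => hv₀ode r hr.1)
  have gcK := gc.mono hsubK
  have vcK := hvc.mono hsubK
  obtain ⟨V, hV⟩ := isCompact_Icc.exists_bound_of_continuousOn gcK
  obtain ⟨M₁, hM₁⟩ := isCompact_Icc.exists_bound_of_continuousOn vcK
  obtain ⟨L, hL⟩ := HC1.exists_lipschitzOnWith (by norm_num) (convex_Icc 0 A) isCompact_Icc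
  have h0K : (0 : ℝ) ∈ Set.Icc 0 K := ⟨le_rfl, hK.le⟩
  have hV0 : 0 ≤ V := (norm_nonneg _).trans (hV 0 h0K)
  set M := max M₁ (((p + 3) / 2) ^ (1 / (p - 1))) with hMdef
  have HL : ∀ r ∈ Set.Icc (0 : ℝ) A, |H r - H 0| ≤ L * r := by
    intro r hr
    have := hL.dist_le_mul r hr 0 ⟨le_rfl, hA.le⟩
    rw [Real.dist_eq, Real.dist_eq, sub_zero, abs_of_nonneg hr.1] at this
    exact this
  have hsl : 0 < Real.sqrt lam := Real.sqrt_pos.2 hlam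
  have hmt : Filter.Tendsto (fun d : ℝ => d * Real.sqrt lam) Filter.atTop Filter.atTop :=
    Filter.tendsto_id.atTop_mul_const hsl
  have hlim : Filter.Tendsto (fun d : ℝ => 2 * ((L * V / (d * Real.sqrt lam) + 1 / d ^ 2 * M) *
      Real.exp ((p * M ^ (p - 1) + 2) * K))) Filter.atTop (nhds 0) := by
    have a1 : Filter.Tendsto (fun d : ℝ => L * V / (d * Real.sqrt lam)) Filter.atTop (nhds 0) :=
      hmt.const_div_atTop _
    have a2 : Filter.Tendsto (fun d : ℝ => 1 / d ^ 2) Filter.atTop (nhds 0) :=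
      (Filter.tendsto_pow_atTop (by norm_num)).const_div_atTop _
    have := ((a1.add (a2.mul_const M)).mul_const
      (Real.exp ((p * M ^ (p - 1) + 2) * K))).const_mul 2
    simpa using this
  refine squeeze_zero' (Filter.Eventually.of_forall fun d => Real.iSup_nonneg fun r => by positivity)
    ?_ hlim
  filter_upwards [Filter.eventually_ge_atTop 1, hmt.eventually_gt_atTop (K / A)] with d hd1 hdK
  have hd : 0 < d := by linarith
  have hm : 0 < d * Real.sqrt lam := by positivity
  have hM0 : 0 ≤ M := le_trans (Real.rpow_nonneg (by linarith) _) (le_max_right _ _)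
  have hD : 0 < d ^ ((2 : ℝ) / (p - 1)) := Real.rpow_pos_of_pos hd _
  have hcD : d ^ (-(2 : ℝ) / (p - 1)) * d ^ ((2 : ℝ) / (p - 1)) = 1 := by
    rw [← Real.rpow_add hd, neg_div, neg_add_cancel, Real.rpow_zero]
  have : Nonempty (Set.Icc (0 : ℝ) K) := ⟨⟨0, h0K⟩⟩
  refine ciSup_le ?_
  rintro ⟨r, hr⟩
  simp only
  rcases eq_or_lt_of_le hr.1 with h | h
  · subst h
    have e1 : deriv (fun s : ℝ => d ^ (-(2 : ℝ) / (p - 1)) *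
                W (d ^ ((2 : ℝ) / (p - 1))) (s / (d * Real.sqrt lam))) 0 = 0 := by
      rw [deriv_const_mul_field]
      have : (fun s : ℝ => W (d ^ ((2 : ℝ) / (p - 1))) (s / (d * Real.sqrt lam))) =
        (fun s : ℝ => W (d ^ ((2 : ℝ) / (p - 1))) ((d * Real.sqrt lam)⁻¹ * s)) := by
        ext s; congr 1; ring
      rw [this, deriv_comp_mul_left, mul_zero, hW'0 _ hD]; simp
    rw [e1, hv₀'0, zero_div, hW0 _ hD, hcD, hv₀0]
    simp only [sub_self, abs_zero, add_zero]
    positivity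
  · have hr2 : r ∈ Set.Ioo 0 (K + 1) := ⟨h, by linarith [hr.2]⟩
    rw [(hg r hr2).1.deriv]
    refine step A p lam (d * Real.sqrt lam) _ (1 / d ^ 2) K L V M hA hp hm
      (Real.rpow_pos_of_pos hd _) ?_ ?_ ?_ (by positivity) ?_ (le_max_right _ _) L.2 hV0 H Hpos
      HC1.continuousOn HL _ (hWC2 _ hD) (hWode _ hD) ?_ v₀ g vcK gcK hv₀0 g0 ?_ hV ?_ ?_ r
      ⟨h, hr.2⟩
    · rw [← Real.rpow_mul hd.le, div_mul_cancel₀ _ (by linarith), Real.rpow_neg hd.le]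
      norm_num
    · rw [mul_pow, Real.sq_sqrt hlam.le]; field_simp
    · rw [div_lt_iff₀ hm]; rw [div_lt_iff₀ hA] at hdK; linarith
    · rw [div_le_one (by positivity)]; nlinarith
    · rw [hW0 _ hD, hcD]
    · intro s hs; exact (hM₁ s hs).trans (le_max_left _ _)
    · intro s hs; exact (hg s ⟨hs.1, by linarith [hs.2]⟩).1
    · intro s hs; exact (hg s ⟨hs.1, by linarith [hs.2]⟩).2
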